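/- Let (G_n) be a sequence of weighted graphs with |G_n| = n and β_max = sup_{i,j,n} β_ij(n) < ∞, converging to an irreducible graphon W, and let k ≥ 2 be a constant. Then there is a constant σ > 0 such that, for all sufficiently large n, at most n/(10β_max) vertices v of G_n have weighted degree d_v = Σ_{w∈[n]} β_vw(n) less than 50kβ_max σ n. -/

import Mathlib

open MeasureTheory Filter Topology

noncomputable section

namespace Percolation

/-- The symmetrized lift of a two-variable real function to `Sym2`. If `f` is symmetric,
`sym2Val f s(a, b) = f a b`. -/
def sym2Val {α : Type*} (f : α → α → ℝ) : Sym2 α → ℝ :=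
  Sym2.lift ⟨fun a b => (f a b + f b a) / 2, fun a b => by simp [add_comm]⟩

/-- The product over the edges of `F` of a symmetric function of the endpoints. -/
def edgeProd {k : ℕ} (F : SimpleGraph (Fin k)) (f : Fin k → Fin k → ℝ) : ℝ := by
  classical exact ∏ e ∈ F.edgeFinset, sym2Val f e

/-- The homomorphism density `t(F, G)` of a finite simple graph `F` in the weighted graph
on `[n]` with edge weights `β`. -/
def homDensityG {n k : ℕ} (β : Fin n → Fin n → ℝ) (F : SimpleGraph (Fin k)) : ℝ :=
  (∑ v : Fin k → Fin n, edgeProd F fun i j => β (v i) (v j)) / (n : ℝ) ^ k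

/-- The unit interval `[0,1] ⊆ ℝ`. -/
def I01 : Set ℝ := Set.Icc 0 1

/-- The homomorphism density `t(F, W)` of a finite simple graph `F` in a graphon `W`. -/
def homDensityW {k : ℕ} (W : ℝ → ℝ → ℝ) (F : SimpleGraph (Fin k)) : ℝ :=
  ∫ x : Fin k → ℝ in Set.univ.pi fun _ => I01, edgeProd F fun i j => W (x i) (x j)

/-- `G_n → W`: convergence of the homomorphism densities for every finite simple graph. -/
def ConvergesTo (β : ∀ n : ℕ, Fin n → Fin n → ℝ) (W : ℝ → ℝ → ℝ) : Prop :=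
  ∀ (k : ℕ) (F : SimpleGraph (Fin k)),
    Tendsto (fun n => homDensityG (β n) F) atTop (nhds (homDensityW W F))

/-- `W` is a graphon: a bounded symmetric measurable function with nonnegative values. -/
def IsGraphon (W : ℝ → ℝ → ℝ) : Prop :=
  Measurable (Function.uncurry W) ∧ (∀ x y, 0 ≤ W x y) ∧ (∀ x y, W x y = W y x) ∧
    ∃ M : ℝ, ∀ x y, W x y ≤ M

/-- The Bernoulli measure on `Bool` with success probability `p`. -/
def bern (p : ℝ) : Measure Bool :=
  ENNReal.ofReal p • Measure.dirac true + ENNReal.ofReal (1 - p) • Measure.dirac false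

/-- The law of the random graph in which each pair `{v, w}` is an edge independently
with probability `min (p * β v w) 1`; a point of the sample space records for each
unordered pair whether it is an edge. -/
def percMeasure {V : Type*} [Fintype V] [DecidableEq V] (β : V → V → ℝ) (p : ℝ) :
    Measure (Sym2 V → Bool) :=
  Measure.pi fun e => bern (min (p * sym2Val β e) 1)

/-- The simple graph determined by a point of the sample space. -/
def graphOf {V : Type*} (ω : Sym2 V → Bool) : SimpleGraph V :=
  SimpleGraph.fromRel fun i j => ω s(i, j)

/-- The number of vertices of the component of `v` in `G`. -/
def compSize {V : Type*} (G : SimpleGraph V) (v : V) : ℕ := {w | G.Reachable v w}.ncard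

/-- The number of vertices of the largest component of `G`. -/
def C1 {V : Type*} [Fintype V] (G : SimpleGraph V) : ℕ :=
  Finset.univ.sup fun v => compSize G v

/-- The number of vertices of the second largest component of `G` (zero if `G` is
connected): the largest value of `min (|C_v|, |C_w|)` over vertices `v`, `w` lying in
distinct components. -/
def C2 {V : Type*} (G : SimpleGraph V) : ℕ :=
  sSup {m | ∃ v w : V, ¬G.Reachable v w ∧ m = min (compSize G v) (compSize G w)}

/-- The operator `T_W` with kernel `W` applied to `f`. -/
def applyT (W : ℝ → ℝ → ℝ) (f : ℝ → ℝ) (x : ℝ) : ℝ := ∫ y in I01, W x y * f y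

/-- The `L²[0,1]` norm of a function. -/
def l2norm (f : ℝ → ℝ) : ℝ := Real.sqrt (∫ x in I01, f x ^ 2)

/-- The `L²`-operator norm `‖T_W‖` of the integral operator with kernel `W`. -/
def opNorm (W : ℝ → ℝ → ℝ) : ℝ :=
  sSup {r | ∃ f : ℝ → ℝ, Measurable f ∧
    MeasureTheory.IntegrableOn (fun x => f x ^ 2) I01 ∧
    l2norm f ≤ 1 ∧ r = l2norm (applyT W f)}

/-- The survival probability `ρ(W)` of the multitype Poisson branching process with
kernel `W`: the supremum of `∫ f` over measurable `f : [0,1] → [0,1]` satisfying the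
functional equation `f(x) = 1 - exp(-∫ W(x,y) f(y) dy)` almost everywhere. -/
def survival (W : ℝ → ℝ → ℝ) : ℝ :=
  sSup {r | ∃ f : ℝ → ℝ, Measurable f ∧ (∀ x, f x ∈ Set.Icc (0 : ℝ) 1) ∧
    (∀ᵐ x ∂volume.restrict I01, f x = 1 - Real.exp (-∫ y in I01, W x y * f y)) ∧
    r = ∫ x in I01, f x}

/-- A graphon `W` is irreducible if there is no measurable `A ⊆ [0,1]` with
`0 < μ(A) < 1` such that `W = 0` a.e. on `A × ([0,1] \ A)`. -/
def Irreducible (W : ℝ → ℝ → ℝ) : Prop :=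
  ¬∃ A : Set ℝ, MeasurableSet A ∧ A ⊆ I01 ∧ 0 < volume A ∧ volume A < 1 ∧
    ∀ᵐ p : ℝ × ℝ, p.1 ∈ A → p.2 ∈ I01 \ A → W p.1 p.2 = 0

end Percolation

namespace Percolation

/-- The star with centre `0` and `j` leaves. -/
def starG (j : ℕ) : SimpleGraph (Fin (j + 1)) :=
  SimpleGraph.fromRel fun a _ => a = 0

lemma edgeProd_star (j : ℕ) (f : Fin (j + 1) → Fin (j + 1) → ℝ)
    (hf : ∀ a b, f a b = f b a) :
    edgeProd (starG j) f = ∏ i : Fin j, f 0 i.succ := by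
  classical
  unfold edgeProd
  have h : (starG j).edgeFinset = Finset.univ.image (fun i : Fin j => s((0 : Fin (j+1)), i.succ)) := by
    ext e
    induction e using Sym2.ind with
    | _ a b =>
      rw [SimpleGraph.mem_edgeFinset, SimpleGraph.mem_edgeSet]
      simp only [starG, SimpleGraph.fromRel_adj, Finset.mem_image, Finset.mem_univ, true_and, Sym2.eq_iff]
      constructor
      · rintro ⟨hne, rfl | rfl⟩
        · obtain ⟨i, rfl⟩ := Fin.exists_succ_eq.2 hne.symm
          exact ⟨i, Or.inl ⟨rfl, rfl⟩⟩
        · obtain ⟨i, rfl⟩ := Fin.exists_succ_eq.2 hne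
          exact ⟨i, Or.inr ⟨rfl, rfl⟩⟩
      · rintro ⟨i, ⟨rfl, rfl⟩ | ⟨rfl, rfl⟩⟩
        · exact ⟨(Fin.succ_ne_zero i).symm, Or.inl rfl⟩
        · exact ⟨(Fin.succ_ne_zero i), Or.inr rfl⟩
  have h2 : ∀ i : Fin j, sym2Val f s(0, i.succ) = f 0 i.succ := by
    intro i
    simp [sym2Val, hf i.succ 0]
  calc _ = ∏ e ∈ Finset.univ.image (fun i : Fin j => s((0 : Fin (j+1)), i.succ)), sym2Val f e := by
        rw [← h]
    _ = _ := by
        rw [Finset.prod_image]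
        · exact Finset.prod_congr rfl fun i _ => h2 i
        · intro a _ b _ hab
          simpa using hab

lemma homDensityG_star {n : ℕ} (j : ℕ) (β : Fin n → Fin n → ℝ) (hβ : ∀ a b, β a b = β b a) :
    homDensityG β (starG j) = (∑ v, ((∑ w, β v w) / n) ^ j) / n := by
  unfold homDensityG
  have : ∀ v : Fin (j + 1) → Fin n, edgeProd (starG j) (fun a b => β (v a) (v b))
      = ∏ i : Fin j, β (v 0) (v i.succ) := fun v => edgeProd_star j _ fun a b => hβ _ _
  simp_rw [this]
  rw [← (Fin.consEquiv fun _ => Fin n).sum_comp, Fintype.sum_prod_type]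
  simp only [Fin.consEquiv, Equiv.coe_fn_mk, Fin.cons_zero, Fin.cons_succ]
  simp_rw [← Fintype.sum_pow, div_pow]
  rw [← Finset.sum_div, pow_succ, div_div]

instance : IsProbabilityMeasure (volume.restrict I01) := ⟨by simp [I01]⟩

lemma homDensityW_star (j : ℕ) (W : ℝ → ℝ → ℝ) (hW : IsGraphon W) :
    homDensityW W (starG j) = ∫ x in I01, (∫ y in I01, W x y) ^ j := by
  obtain ⟨hm, h0, hs, M, hM⟩ := hW
  unfold homDensityW
  have : ∀ v : Fin (j + 1) → ℝ, edgeProd (starG j) (fun a b => W (v a) (v b))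
      = ∏ i : Fin j, W (v 0) (v i.succ) := fun v => edgeProd_star j _ fun a b => hs _ _
  simp_rw [this]
  rw [volume_pi, Measure.restrict_pi_pi]
  have hmp := measurePreserving_piFinSuccAbove (fun _ : Fin (j+1) => (volume.restrict I01 : Measure ℝ)) 0
  have hg := hmp.integral_comp' (g := fun p : ℝ × (Fin j → ℝ) => ∏ i, W p.1 (p.2 i))
  have hg' : ∫ x : Fin (j+1) → ℝ, ∏ i : Fin j, W (x 0) (x i.succ) ∂(Measure.pi fun _ => volume.restrict I01)
     = ∫ p : ℝ × (Fin j → ℝ), ∏ i, W p.1 (p.2 i) ∂((volume.restrict I01).prod (Measure.pi fun _ => volume.restrict I01)) := hg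
  rw [hg', integral_prod]
  · refine integral_congr_ae (Eventually.of_forall fun x => ?_)
    simp only
    rw [integral_fintype_prod_eq_pow]
    simp
  · refine Integrable.of_bound (C := M ^ j) ?_ (Eventually.of_forall fun p => ?_)
    · refine Measurable.aestronglyMeasurable ?_
      refine Finset.measurable_prod _ fun i _ => ?_
      exact hm.comp (measurable_fst.prodMk ((measurable_pi_apply i).comp measurable_snd))
    · rw [Real.norm_of_nonneg (Finset.prod_nonneg fun i _ => h0 _ _)]
      calc _ ≤ ∏ i : Fin j, M := Finset.prod_le_prod (fun i _ => h0 _ _) fun i _ => hM _ _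
        _ = _ := by simp

lemma measurable_deg (W : ℝ → ℝ → ℝ) (hW : IsGraphon W) :
    Measurable fun x => ∫ y in I01, W x y :=
  (hW.1.stronglyMeasurable.integral_prod_right).measurable

lemma deg_nonneg (W : ℝ → ℝ → ℝ) (hW : IsGraphon W) (x : ℝ) : 0 ≤ ∫ y in I01, W x y :=
  integral_nonneg fun y => hW.2.1 x y

lemma integrable_W (W : ℝ → ℝ → ℝ) (hW : IsGraphon W) (x : ℝ) :
    Integrable (fun y => W x y) (volume.restrict I01) := by
  obtain ⟨hm, h0, hs, M, hM⟩ := hW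
  refine Integrable.of_bound (C := M) (hm.comp measurable_prodMk_left).aestronglyMeasurable
    (Eventually.of_forall fun y => ?_)
  rw [Real.norm_of_nonneg (h0 _ _)]
  exact hM _ _

lemma deg_le (W : ℝ → ℝ → ℝ) (hW : IsGraphon W) (M : ℝ) (hM : ∀ x y, W x y ≤ M) (x : ℝ) :
    ∫ y in I01, W x y ≤ M := by
  calc _ ≤ ∫ y in I01, M := integral_mono (integrable_W W hW x) (integrable_const _) fun y => hM x y
    _ = M := by simp

lemma deg_pos (W : ℝ → ℝ → ℝ) (hW : IsGraphon W) (hirr : Percolation.Irreducible W) :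
    ∀ᵐ x ∂volume.restrict I01, 0 < ∫ y in I01, W x y := by
  have hmI : MeasurableSet I01 := measurableSet_Icc
  have key : ∀ A : Set ℝ, MeasurableSet A → A ⊆ I01 → (∀ x ∈ A, ∫ y in I01, W x y = 0) →
      volume A < 1 → volume A = 0 := by
    intro A hA hAI hA0 hA1
    by_contra hne
    refine hirr ⟨A, hA, hAI, pos_iff_ne_zero.2 hne, hA1, ?_⟩
    rw [Measure.volume_eq_prod, Measure.ae_prod_iff_ae_ae]
    · refine Eventually.of_forall fun x => ?_
      by_cases hx : x ∈ A
      · have := (integral_eq_zero_iff_of_nonneg (fun y => hW.2.1 x y) (integrable_W W hW x)).1 (hA0 x hx)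
        rw [Filter.EventuallyEq, ae_restrict_iff' hmI] at this
        filter_upwards [this] with y hy _ hy2
        exact hy hy2.1
      · exact Eventually.of_forall fun y h => absurd h hx
    · have h1 : MeasurableSet {p : ℝ × ℝ | p.1 ∈ A} := measurable_fst hA
      have h2 : MeasurableSet {p : ℝ × ℝ | p.2 ∈ I01 \ A} := measurable_snd (hmI.diff hA)
      have h3 : MeasurableSet {p : ℝ × ℝ | W p.1 p.2 = 0} := hW.1 (measurableSet_singleton 0)
      exact MeasurableSet.imp h1 (MeasurableSet.imp h2 h3)
  set Z : Set ℝ := {x | ∫ y in I01, W x y = 0} with hZ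
  have hmZ : MeasurableSet Z := measurable_deg W hW (measurableSet_singleton 0)
  have half : ∀ a b : ℝ, 0 ≤ a → b ≤ 1 → b - a ≤ 1/2 → volume (Z ∩ Set.Icc a b) = 0 := by
    intro a b ha hb hab
    refine key _ (hmZ.inter measurableSet_Icc) (fun x hx => ⟨ha.trans hx.2.1, hx.2.2.trans hb⟩)
      (fun x hx => hx.1) ?_
    calc volume (Z ∩ Set.Icc a b) ≤ volume (Set.Icc a b) := measure_mono Set.inter_subset_right
      _ = ENNReal.ofReal (b - a) := Real.volume_Icc
      _ < 1 := by rw [ENNReal.ofReal_lt_one]; linarith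
  have h1 := half 0 (1/2) le_rfl (by norm_num) (by norm_num)
  have h2 := half (1/2) 1 (by norm_num) le_rfl (by norm_num)
  rw [ae_restrict_iff' hmI, ae_iff]
  refine measure_mono_null ?_ (measure_union_null h1 h2)
  intro x hx
  simp only [Set.mem_setOf_eq, not_forall, not_lt] at hx
  obtain ⟨hx1, hx2⟩ := hx
  have hxZ : x ∈ Z := le_antisymm hx2 (deg_nonneg W hW x)
  rcases le_total x (1/2) with h | h
  · exact Or.inl ⟨hxZ, hx1.1, h⟩
  · exact Or.inr ⟨hxZ, h, hx1.2⟩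

lemma binom_expand (B x : ℝ) (m : ℕ) :
    (1 - x / B) ^ m = ∑ j ∈ Finset.range (m + 1), ((-1 / B) ^ j * (m.choose j)) * x ^ j := by
  rw [show (1 - x / B) = (-1 / B * x) + 1 by ring, add_pow]
  refine Finset.sum_congr rfl fun j _ => ?_
  rw [mul_pow]; ring

lemma tendsto_binom (β : ∀ n : ℕ, Fin n → Fin n → ℝ) (hsym : ∀ n i j, β n i j = β n j i)
    (W : ℝ → ℝ → ℝ) (hW : IsGraphon W) (hconv : ConvergesTo β W) (B : ℝ) (m : ℕ) :
    Tendsto (fun n : ℕ => (∑ v, (1 - ((∑ w, β n v w) / n) / B) ^ m) / (n : ℝ)) atTop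
      (nhds (∫ x in I01, (1 - (∫ y in I01, W x y) / B) ^ m)) := by
  have h1 : ∀ n : ℕ, (∑ v, (1 - ((∑ w, β n v w) / n) / B) ^ m) / (n : ℝ)
      = ∑ j ∈ Finset.range (m + 1), ((-1 / B) ^ j * (m.choose j)) * homDensityG (β n) (starG j) := by
    intro n
    simp_rw [binom_expand, homDensityG_star _ (β n) (hsym n)]
    rw [Finset.sum_comm, Finset.sum_div]
    simp_rw [← Finset.mul_sum, mul_div_assoc]
  have h2 : ∫ x in I01, (1 - (∫ y in I01, W x y) / B) ^ m
      = ∑ j ∈ Finset.range (m + 1), ((-1 / B) ^ j * (m.choose j)) * homDensityW W (starG j) := by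
    simp_rw [binom_expand, homDensityW_star _ W hW]
    rw [integral_finset_sum]
    · simp_rw [integral_const_mul]
    · intro j _
      refine Integrable.const_mul ?_ _
      obtain ⟨M, hM⟩ := hW.2.2.2
      refine Integrable.of_bound (C := M ^ j) ((measurable_deg W hW).pow_const j).aestronglyMeasurable
        (Eventually.of_forall fun x => ?_)
      rw [Real.norm_of_nonneg (pow_nonneg (deg_nonneg W hW x) _)]
      exact pow_le_pow_left₀ (deg_nonneg W hW x) (deg_le W hW M hM x) j
  simp_rw [h1, h2]
  exact tendsto_finset_sum _ fun j _ => (hconv _ (starG j)).const_mul _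

lemma tendsto_zero (W : ℝ → ℝ → ℝ) (hW : IsGraphon W) (hirr : Percolation.Irreducible W)
    (B : ℝ) (hB : 0 < B) (hWB : ∀ x y, W x y ≤ B) :
    Tendsto (fun m : ℕ => ∫ x in I01, (1 - (∫ y in I01, W x y) / B) ^ m) atTop (nhds 0) := by
  have hle : ∀ x, (∫ y in I01, W x y) / B ≤ 1 := fun x =>
    (div_le_one hB).2 (deg_le W hW B hWB x)
  have hge : ∀ x, 0 ≤ (∫ y in I01, W x y) / B := fun x => div_nonneg (deg_nonneg W hW x) hB.le
  have := tendsto_integral_of_dominated_convergence (μ := volume.restrict I01)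
    (F := fun (m : ℕ) x => (1 - (∫ y in I01, W x y) / B) ^ m) (f := fun _ => (0:ℝ))
    (fun _ => (1:ℝ)) (fun m => ((((measurable_deg W hW).div_const B).const_sub 1).pow_const m).aestronglyMeasurable)
    (integrable_const _)
    (fun m => Eventually.of_forall fun x => by
      rw [Real.norm_of_nonneg (pow_nonneg (by linarith [hle x]) _)]
      exact pow_le_one₀ (by linarith [hle x]) (by linarith [hge x]))
    (by
      filter_upwards [deg_pos W hW hirr] with x hx
      refine tendsto_pow_atTop_nhds_zero_of_lt_one (by linarith [hle x]) ?_
      have := div_pos hx hB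
      linarith)
  simpa using this

end Percolation
open Percolation MeasureTheory Filter Topology in
/-- If `(G_n)` converges to an irreducible graphon `W` and `k ≥ 2` is
a constant, then there is `σ > 0` such that for all sufficiently large `n`, at most
`n/(10 βmax)` vertices of `G_n` have weighted degree less than `50 k βmax σ n`. -/
theorem few_low_degree_vertices
    (β : ∀ n : ℕ, Fin n → Fin n → ℝ) (βmax : ℝ)
    (hsym : ∀ n i j, β n i j = β n j i)
    (hnonneg : ∀ n i j, 0 ≤ β n i j)
    (hdiag : ∀ n i, β n i i = 0)
    (hbound : ∀ n i j, β n i j ≤ βmax)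
    (W : ℝ → ℝ → ℝ) (hW : IsGraphon W) (hconv : ConvergesTo β W)
    (hirr : Percolation.Irreducible W)
    (k : ℕ) (hk : 2 ≤ k) :
    ∃ σ : ℝ, 0 < σ ∧ ∀ᶠ n : ℕ in atTop,
      (({v : Fin n | (∑ w, β n v w) < 50 * k * βmax * σ * n}.ncard : ℝ)) ≤
        n / (10 * βmax) := by
  by_cases hβ : βmax ≤ 0
  · refine ⟨1, one_pos, ?_⟩
    filter_upwards [eventually_ge_atTop 1] with n hn
    have h0 : βmax = 0 := le_antisymm hβ
      ((hnonneg n ⟨0, hn⟩ ⟨0, hn⟩).trans (hbound n _ _))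
    have : {v : Fin n | (∑ w, β n v w) < 50 * k * βmax * 1 * n} = ∅ := by
      ext v
      simp only [Set.mem_setOf_eq, Set.mem_empty_iff_false, iff_false, not_lt, h0]
      simpa using Finset.sum_nonneg fun w _ => hnonneg n v w
    rw [this]
    simp [h0]
  push Not at hβ
  obtain ⟨M, hM⟩ := hW.2.2.2
  set B := max βmax M with hBdef
  have hβB : βmax ≤ B := le_max_left _ _
  have hB : 0 < B := hβ.trans_le hβB
  have hWB : ∀ x y, W x y ≤ B := fun x y => (hM x y).trans (le_max_right _ _)
  have hε : 0 < 1 / (20 * βmax) := by positivity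
  obtain ⟨m, hm1, hm⟩ := ((eventually_ge_atTop 1).and
    ((tendsto_zero W hW hirr B hB hWB).eventually (gt_mem_nhds hε))).exists
  have hmpos : (0 : ℝ) < m := by exact_mod_cast hm1
  have hkpos : (0 : ℝ) < k := by exact_mod_cast (by omega : 0 < k)
  refine ⟨B / (2 * m) / (50 * k * βmax), by positivity, ?_⟩
  filter_upwards [(tendsto_binom β hsym W hW hconv B m).eventually (gt_mem_nhds hm),
    eventually_ge_atTop 1] with n hn hn1
  have hnpos : (0 : ℝ) < n := by exact_mod_cast hn1
  have hc : 50 * k * βmax * (B / (2 * m) / (50 * k * βmax)) * n = B / (2 * m) * n := by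
    field_simp
  rw [hc]
  classical
  set S : Finset (Fin n) := Finset.univ.filter fun v => (∑ w, β n v w) < B / (2 * m) * n with hS
  have hcard : {v : Fin n | (∑ w, β n v w) < B / (2 * m) * n}.ncard = S.card := by
    rw [← Set.ncard_coe_finset]
    congr 1
    ext v
    simp [hS]
  rw [hcard]
  have hdle : ∀ v, (∑ w, β n v w) / n / B ≤ 1 := by
    intro v
    rw [div_le_one hB, div_le_iff₀ hnpos]
    calc _ ≤ ∑ w : Fin n, βmax := Finset.sum_le_sum fun w _ => hbound n v w
      _ = n * βmax := by simp
      _ ≤ B * n := by nlinarith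
  have hlow : (S.card : ℝ) * (1 / 2) ≤ ∑ v, (1 - ((∑ w, β n v w) / n) / B) ^ m := by
    calc (S.card : ℝ) * (1 / 2) = ∑ v ∈ S, (1 / 2 : ℝ) := by simp
      _ ≤ ∑ v ∈ S, (1 - ((∑ w, β n v w) / n) / B) ^ m := by
        refine Finset.sum_le_sum fun v hv => ?_
        have hv' : (∑ w, β n v w) < B / (2 * m) * n := by simpa [hS] using hv
        have h1 : (∑ w, β n v w) / n / B ≤ 1 / (2 * m) := by
          rw [div_le_iff₀ hB, div_le_iff₀ hnpos]
          calc _ ≤ _ := hv'.le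
            _ = _ := by ring
        have h2 := one_add_mul_le_pow (a := -((∑ w, β n v w) / n / B)) (by linarith [hdle v]) m
        have h3 : (m : ℝ) * ((∑ w, β n v w) / n / B) ≤ 1 / 2 := by
          calc _ ≤ (m : ℝ) * (1 / (2 * m)) := by gcongr
            _ = 1 / 2 := by field_simp
        rw [← sub_eq_add_neg, mul_neg] at h2
        linarith
      _ ≤ _ := Finset.sum_le_sum_of_subset_of_nonneg (Finset.subset_univ _)
          fun v _ _ => pow_nonneg (by linarith [hdle v]) _
  rw [div_lt_iff₀ hnpos] at hn
  have : (n : ℝ) / (10 * βmax) = 2 * (1 / (20 * βmax) * n) := by field_simp; norm_num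
  rw [this]
  linarith
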